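/- For every complex s with Re(s) > r, one has ζ_a(s) = (1/(D^s (r−1)!)) · [ ∑_{(j_1,…,j_r): a_1j_1+⋯+a_rj_r ≢ 0 (mod D)} ∑_{k=0}^{r−1} ∑_{j=0}^{k} [r,k] (−1)^j C(k,j) ((a_1j_1+⋯+a_rj_r)/D)^j · ζ(s−k+j, 𝔯(j_1,…,j_r)/D) + ∑_{(j_1,…,j_r): a_1j_1+⋯+a_rj_r ≡ 0 (mod D)} ∑_{k=0}^{r−1} ∑_{j=0}^{k} [r,k] (−1)^j C(k,j) ((a_1j_1+⋯+a_rj_r)/D)^j · ζ(s−k+j) ], where in both outer sums (j_1,…,j_r) runs over integers 0 ≤ j_1 ≤ D/a_1 − 1, …, 0 ≤ j_r ≤ D/a_r − 1, and 𝔯(j_1,…,j_r) ∈ {0,1,…,D−1} is the remainder of a_1j_1+⋯+a_rj_r modulo D. -/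

import Mathlib

/-- Hurwitz zeta function as a series: `ζ(s,w) = ∑_{n≥0} (n+w)^{-s}`. -/
noncomputable def hurwitzZetaSeries (s w : ℂ) : ℂ := ∑' n : ℕ, ((n : ℂ) + w) ^ (-s)

/-- The restricted partition function: the number of tuples `(x₁,…,x_r)` of nonnegative
integers with `a₁x₁+⋯+a_rx_r = n`. -/
noncomputable def restrictedPartition (r : ℕ) (a : Fin r → ℕ) (n : ℕ) : ℕ :=
  Nat.card {x : Fin r → ℕ // ∑ i, a i * x i = n}

theorem Nat.card_pi_sum_eq (r m : ℕ) :
    Nat.card {y : Fin r → ℕ // ∑ i, y i = m} = (r + m - 1).choose m := by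
  classical
  rw [← Nat.card_congr (Sym.equivNatSumOfFintype (Fin r) m), Nat.card_eq_fintype_card,
    Sym.card_sym_eq_choose, Fintype.card_fin]

/-- Splitting each coordinate `x i` into its remainder and quotient modulo `D / a i`. -/
def piDivModEquiv {r : ℕ} (b : Fin r → ℕ) (hb : ∀ i, 0 < b i) :
    (Fin r → ℕ) ≃ (∀ i, Fin (b i)) × (Fin r → ℕ) where
  toFun x := (fun i => ⟨x i % b i, Nat.mod_lt _ (hb i)⟩, fun i => x i / b i)
  invFun p i := p.1 i + b i * p.2 i
  left_inv x := by
    funext i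
    exact Nat.mod_add_div _ _
  right_inv p := by
    refine Prod.ext ?_ ?_ <;> funext i
    · ext
      simp [Nat.mod_eq_of_lt (p.1 i).2]
    · simp [Nat.add_mul_div_left _ _ (hb i), Nat.div_eq_of_lt (p.1 i).2]

theorem finite_add_mul_sum_eq (r S n : ℕ) {D : ℕ} (hD : 0 < D) :
    Finite {y : Fin r → ℕ // S + D * ∑ i, y i = n} := by
  refine Set.Finite.subset (Set.finite_Iic fun _ : Fin r => n) fun y hy i => ?_
  have h₁ : y i ≤ ∑ i, y i := Finset.single_le_sum (fun _ _ => Nat.zero_le _) (Finset.mem_univ i)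
  have h₂ : ∑ i, y i ≤ D * ∑ i, y i := Nat.le_mul_of_pos_left _ hD
  have h₃ : S + D * ∑ i, y i = n := hy
  change y i ≤ n
  omega

theorem restrictedPartition_eq_sum {r : ℕ} {a : Fin r → ℕ} {D : ℕ} (hD : 0 < D)
    (hdvd : ∀ i, a i ∣ D) (n : ℕ) :
    restrictedPartition r a n = ∑ j : ∀ i : Fin r, Fin (D / a i),
      Nat.card {y : Fin r → ℕ // (∑ i, a i * (j i : ℕ)) + D * ∑ i, y i = n} := by
  have hb (i : Fin r) : 0 < D / a i :=
    Nat.div_pos (Nat.le_of_dvd hD (hdvd i)) (Nat.pos_of_dvd_of_pos (hdvd i) hD)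
  have := fun j : ∀ i : Fin r, Fin (D / a i) =>
    finite_add_mul_sum_eq r (∑ i, a i * (j i : ℕ)) n hD
  rw [← Nat.card_sigma, restrictedPartition]
  refine Nat.card_congr (((piDivModEquiv (fun i => D / a i) hb).symm.subtypeEquiv
    fun p => ?_).symm.trans (Equiv.subtypeProdEquivSigmaSubtype
      fun (j : ∀ i : Fin r, Fin (D / a i)) (y : Fin r → ℕ) =>
        (∑ i, a i * (j i : ℕ)) + D * ∑ i, y i = n))
  simp only [piDivModEquiv, Equiv.coe_fn_symm_mk, mul_add, ← mul_assoc,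
    Nat.mul_div_cancel' (hdvd _), Finset.sum_add_distrib, Finset.mul_sum]

theorem factorial_mul_card_add_mul_sum_eq {r S D : ℕ} (hr : 1 ≤ r) (hD : 0 < D) (hS : S < D * r)
    (n : ℕ) :
    ((r - 1).factorial : ℂ) * Nat.card {y : Fin r → ℕ // S + D * ∑ i, y i = n} =
      if S ≡ n [MOD D] then
        ∏ i ∈ Finset.range (r - 1), (((n : ℂ) - S) / D + (i + 1 : ℕ)) else 0 := by
  have hD' : (D : ℂ) ≠ 0 := by exact_mod_cast hD.ne'
  split_ifs with h
  · rcases le_or_gt S n with hle | hlt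
    · obtain ⟨m, hm⟩ := (Nat.modEq_iff_dvd' hle).1 h
      obtain rfl : n = S + D * m := by omega
      have hcard : Nat.card {y : Fin r → ℕ // S + D * ∑ i, y i = S + D * m} =
          (m + (r - 1)).choose (r - 1) := by
        simp only [add_right_inj, mul_right_inj' hD.ne']
        rw [Nat.card_pi_sum_eq, ← Nat.choose_symm (by omega)]
        congr 1 <;> omega
      rw [hcard, ← Nat.cast_mul, ← Nat.ascFactorial_eq_factorial_mul_choose,
        Nat.ascFactorial_eq_prod_range, Nat.cast_prod]
      refine Finset.prod_congr rfl fun i _ => ?_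
      push_cast
      field_simp
      ring
    · obtain ⟨m, hm⟩ := (Nat.modEq_iff_dvd' hlt.le).1 h.symm
      obtain rfl : S = n + D * m := by omega
      have hm0 : 0 < m := Nat.pos_of_ne_zero (by rintro rfl; simp at hlt)
      have hmr : m < r := Nat.lt_of_mul_lt_mul_left (a := D) (by omega)
      have : IsEmpty {y : Fin r → ℕ // n + D * m + D * ∑ i, y i = n} :=
        ⟨fun y => by have := y.2; omega⟩
      rw [Nat.card_of_isEmpty, Nat.cast_zero, mul_zero, eq_comm]
      refine Finset.prod_eq_zero (i := m - 1) (Finset.mem_range.2 (by omega)) ?_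
      rw [Nat.sub_add_cancel hm0]
      push_cast
      field_simp
      ring
  · have : IsEmpty {y : Fin r → ℕ // S + D * ∑ i, y i = n} := by
      refine ⟨fun y => h ?_⟩
      rw [← y.2]
      simp [Nat.ModEq]
    rw [Nat.card_of_isEmpty, Nat.cast_zero, mul_zero]

theorem hasSum_hurwitzZetaSeries {w : ℝ} (hw : w ∈ Set.Icc 0 1) {s : ℂ} (hs : 1 < s.re) :
    HasSum (fun n : ℕ => ((n : ℂ) + w) ^ (-s)) (hurwitzZetaSeries s w) := by
  have h := (HurwitzZeta.hasSum_hurwitzZeta_of_one_lt_re hw hs).summable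
  simp only [one_div, ← Complex.cpow_neg] at h
  exact h.hasSum

theorem sum_mul_cpow_neg_eq (r : ℕ) (c : ℕ → ℕ) (s u : ℂ) {x : ℂ} (hx : x ≠ 0) :
    (∑ k ∈ Finset.range r, (c k : ℂ) * (x - u) ^ k) * x ^ (-s) =
      ∑ k ∈ Finset.range r, ∑ l ∈ Finset.range (k + 1),
        (c k : ℂ) * (-1) ^ l * (k.choose l : ℂ) * u ^ l * x ^ (-(s - k + l)) := by
  rw [Finset.sum_mul]
  refine Finset.sum_congr rfl fun k _ => ?_
  rw [sub_eq_neg_add, add_pow, Finset.mul_sum, Finset.sum_mul]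
  refine Finset.sum_congr rfl fun l hl => ?_
  have hlk : l ≤ k := Nat.lt_succ_iff.1 (Finset.mem_range.1 hl)
  have hexp : -(s - k + l) = ((k - l : ℕ) : ℂ) + -s := by
    rw [Nat.cast_sub hlk]
    ring
  rw [hexp, Complex.cpow_add _ _ hx, Complex.cpow_natCast, neg_pow]
  ring

theorem hasSum_progression {r S D R : ℕ} (hD : 0 < D) (hR : 0 < R) (hRD : R ≤ D)
    (hSR : S ≡ R [MOD D]) (c : ℕ → ℕ) {s : ℂ} (hs : (r : ℝ) < s.re) :
    HasSum (fun n : ℕ => if S ≡ n + 1 [MOD D] then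
        (∑ k ∈ Finset.range r, (c k : ℂ) * ((((n + 1 : ℕ) : ℂ) - S) / D) ^ k) *
          ((n + 1 : ℕ) : ℂ) ^ (-s) else 0)
      ((D : ℂ) ^ (-s) * ∑ k ∈ Finset.range r, ∑ l ∈ Finset.range (k + 1),
        (c k : ℂ) * (-1) ^ l * (k.choose l : ℂ) * ((S : ℂ) / D) ^ l *
          hurwitzZetaSeries (s - k + l) ((R : ℂ) / D)) := by
  have hD' : (D : ℂ) ≠ 0 := by exact_mod_cast hD.ne'
  have hDR : (0 : ℝ) < D := by exact_mod_cast hD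
  have hinj : Function.Injective fun m : ℕ => D * m + R - 1 := by
    intro m m' h
    have : D * m = D * m' := by
      simp only at h
      omega
    exact Nat.eq_of_mul_eq_mul_left hD this
  rw [← hinj.hasSum_iff]
  · have hw : (R / D : ℝ) ∈ Set.Icc (0 : ℝ) 1 :=
      ⟨by positivity, (div_le_one hDR).2 (by exact_mod_cast hRD)⟩
    have hterm := HasSum.mul_left ((D : ℂ) ^ (-s)) <|
      hasSum_sum (s := Finset.range r) fun k hk =>
        hasSum_sum (s := Finset.range (k + 1)) fun l _ =>
          HasSum.mul_left ((c k : ℂ) * (-1) ^ l * (k.choose l : ℂ) * ((S : ℂ) / D) ^ l) <|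
            hasSum_hurwitzZetaSeries hw (s := s - k + l) (by
              have hk' : (k : ℝ) + 1 ≤ r := by exact_mod_cast Finset.mem_range.1 hk
              have hl : (0 : ℝ) ≤ l := l.cast_nonneg
              simp only [Complex.add_re, Complex.sub_re, Complex.natCast_re]
              linarith)
    push_cast at hterm
    refine hterm.congr_fun ?_
    intro m
    have hRD' : D * m + R - 1 + 1 = D * m + R := by omega
    have hmod : S ≡ D * m + R [MOD D] := hSR.trans (by simp [Nat.ModEq])
    have hx : ((D * m + R : ℕ) : ℂ) = D * (m + R / D) := by
      push_cast
      field_simp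
    have hx0 : (m : ℂ) + R / D ≠ 0 := by
      intro h
      rw [h, mul_zero, Nat.cast_eq_zero] at hx
      omega
    have hpow : ((D : ℂ) * (m + R / D)) ^ (-s) = (D : ℂ) ^ (-s) * ((m : ℂ) + R / D) ^ (-s) := by
      have := Complex.mul_cpow_ofReal_nonneg (a := D) (b := m + R / D) (by positivity)
        (by positivity) (-s)
      push_cast at this
      exact this
    have hdiv : ((D : ℂ) * (m + R / D) - S) / D = (m + R / D) - S / D := by
      field_simp
    rw [Function.comp_apply, hRD', if_pos hmod, hx, hpow, hdiv, mul_left_comm,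
      sum_mul_cpow_neg_eq r c s _ hx0]
  · intro n hn
    refine if_neg fun h => hn ?_
    have h' : R ≡ n + 1 [MOD D] := hSR.symm.trans h
    have hle : R ≤ n + 1 := by
      by_contra! hlt
      have hd := Nat.le_of_dvd (by omega) ((Nat.modEq_iff_dvd' hlt.le).1 h'.symm)
      omega
    obtain ⟨m, hm⟩ := (Nat.modEq_iff_dvd' hle).1 h'
    exact ⟨m, by simp only; omega⟩

/-- Lemma 1.3: decomposition of the Dirichlet series `ζ_a(s) = ∑_{n≥1} p_a(n) n^{-s}`
into Hurwitz zeta values and Riemann zeta values. -/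
theorem dirichlet_series_decomposition
    (r : ℕ) (hr : 1 ≤ r) (a : Fin r → ℕ) (ha : ∀ i, 0 < a i)
    (D : ℕ) (hD : 0 < D) (hdvd : ∀ i, a i ∣ D)
    (c : ℕ → ℕ)
    (hc : ∀ x : ℂ, ∏ i ∈ Finset.range (r - 1), (x + (i + 1 : ℕ)) =
      ∑ k ∈ Finset.range r, (c k : ℂ) * x ^ k)
    (s : ℂ) (hs : (r : ℝ) < s.re) :
    (∑' n : ℕ, (restrictedPartition r a (n + 1) : ℂ) * (((n + 1 : ℕ)) : ℂ) ^ (-s)) =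
      1 / ((D : ℂ) ^ s * (Nat.factorial (r - 1) : ℂ)) *
        ((∑ j ∈ Finset.univ.filter
            (fun j : ∀ i : Fin r, Fin (D / a i) => ¬ (D ∣ ∑ i, a i * (j i : ℕ))),
          ∑ k ∈ Finset.range r,
            ∑ l ∈ Finset.range (k + 1),
              (c k : ℂ) * (-1) ^ l * (k.choose l : ℂ) *
                (((∑ i, a i * (j i : ℕ) : ℕ) : ℂ) / (D : ℂ)) ^ l *
                hurwitzZetaSeries (s - (k : ℂ) + (l : ℂ))
                  ((((∑ i, a i * (j i : ℕ)) % D : ℕ) : ℂ) / (D : ℂ))) +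
        ∑ j ∈ Finset.univ.filter
            (fun j : ∀ i : Fin r, Fin (D / a i) => D ∣ ∑ i, a i * (j i : ℕ)),
          ∑ k ∈ Finset.range r,
            ∑ l ∈ Finset.range (k + 1),
              (c k : ℂ) * (-1) ^ l * (k.choose l : ℂ) *
                (((∑ i, a i * (j i : ℕ) : ℕ) : ℂ) / (D : ℂ)) ^ l *
                hurwitzZetaSeries (s - (k : ℂ) + (l : ℂ)) 1) := by
  have hfac : ((r - 1).factorial : ℂ) ≠ 0 := by exact_mod_cast (r - 1).factorial_ne_zero
  have hlt (j : ∀ i : Fin r, Fin (D / a i)) : ∑ i, a i * (j i : ℕ) < D * r := by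
    have : Nonempty (Fin r) := ⟨⟨0, hr⟩⟩
    calc ∑ i, a i * (j i : ℕ) < ∑ _i : Fin r, D :=
          Finset.sum_lt_sum_of_nonempty Finset.univ_nonempty fun i _ =>
            (Nat.mul_lt_mul_of_pos_left (j i).2 (ha i)).trans_le (Nat.mul_div_le _ _)
      _ = D * r := by simp [mul_comm]
  have hterm (n : ℕ) : (restrictedPartition r a (n + 1) : ℂ) * (((n + 1 : ℕ)) : ℂ) ^ (-s) =
      ((r - 1).factorial : ℂ)⁻¹ * ∑ j : ∀ i : Fin r, Fin (D / a i),
        if ∑ i, a i * (j i : ℕ) ≡ n + 1 [MOD D] then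
          (∑ k ∈ Finset.range r,
            (c k : ℂ) * ((((n + 1 : ℕ) : ℂ) - (∑ i, a i * (j i : ℕ) : ℕ)) / D) ^ k) *
            ((n + 1 : ℕ) : ℂ) ^ (-s) else 0 := by
    rw [eq_inv_mul_iff_mul_eq₀ hfac, restrictedPartition_eq_sum hD hdvd, Nat.cast_sum,
      ← mul_assoc, Finset.mul_sum, Finset.sum_mul]
    refine Finset.sum_congr rfl fun j _ => ?_
    rw [factorial_mul_card_add_mul_sum_eq hr hD (hlt j), hc, ite_mul, zero_mul]
  simp_rw [hterm]
  have hprog (j : ∀ i : Fin r, Fin (D / a i)) := hasSum_progression (r := r)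
    (S := ∑ i, a i * (j i : ℕ)) (R := if D ∣ ∑ i, a i * (j i : ℕ) then D
      else (∑ i, a i * (j i : ℕ)) % D) hD
    (by
      split_ifs with h
      · exact hD
      · exact Nat.pos_of_ne_zero fun h' => h (Nat.dvd_of_mod_eq_zero h'))
    (by
      split_ifs
      · exact le_rfl
      · exact (Nat.mod_lt _ hD).le)
    (by
      split_ifs with h
      · exact ((Nat.modEq_zero_iff_dvd).2 h).trans ((Nat.modEq_zero_iff_dvd).2 dvd_rfl).symm
      · exact (Nat.mod_modEq _ _).symm) c hs
  rw [((hasSum_sum fun j _ => hprog j).mul_left _).tsum_eq, ← Finset.mul_sum, ← mul_assoc,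
    Complex.cpow_neg, ← mul_inv, mul_comm ((r - 1).factorial : ℂ), ← one_div]
  congr 1
  rw [← Finset.sum_filter_not_add_sum_filter
    (p := fun j : ∀ i : Fin r, Fin (D / a i) => D ∣ ∑ i, a i * (j i : ℕ))]
  congr 1
  · refine Finset.sum_congr rfl fun j hj => ?_
    simp only [if_neg (Finset.mem_filter.1 hj).2]
  · refine Finset.sum_congr rfl fun j hj => ?_
    simp only [if_pos (Finset.mem_filter.1 hj).2,
      div_self (Nat.cast_ne_zero.2 hD.ne' : (D : ℂ) ≠ 0)]
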